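/- Let ν, μ, z ∈ ℂ with Re ν > 0, 0 < Re μ < 2 and Re μ < Re ν + 1. Then (e^(−z²/2)/(Γ(ν)·Γ(ν+1−μ))) · [ (∫₀^∞ e^(−z·t − t²/2) t^(ν−1) dt)·(∫₀^∞ e^(z·s − s²/2) s^(ν−μ) ds) + (∫₀^∞ e^(z·t − t²/2) t^(ν−1) dt)·(∫₀^∞ e^(−z·s − s²/2) s^(ν−μ) ds) ] = (4/√(2π)) · sin(πμ/2) · ∫₀^∞ cos(z·x) · x^(μ−1) · e^(−x²/2) · ((1/Γ(ν)) ∫₀^∞ e^(−x²·u) u^(ν−1)(1+u)^(μ−ν−1) du) dx. (This is the Fourier-cosine identity (26): D₋ν(z)·D_(μ−1−ν)(−z) + D₋ν(−z)·D_(μ−1−ν)(z) = (4/√(2π)) sin(πμ/2) ∫₀^∞ cos(zx) x^(μ−1) e^(−x²/2) Ψ(ν,μ;x²) dx with a = 1.) -/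

import Mathlib

open MeasureTheory Complex Set

theorem pc_holo {α : Type*} [MeasurableSpace α] {m : Measure α} {F : ℂ → α → ℂ} {U : Set ℂ}
    (hmeas : ∀ w, AEStronglyMeasurable (F w) m)
    (hdiff : ∀ a, Differentiable ℂ (fun w => F w a))
    (hb : ∀ w0 ∈ U, ∃ r > 0, ∃ bd : α → ℝ, Integrable bd m ∧
      ∀ᵐ a ∂m, ∀ w ∈ Metric.ball w0 r, ‖F w a‖ ≤ bd a) :
    ∀ w0 ∈ U, DifferentiableAt ℂ (fun w => ∫ a, F w a ∂m) w0 := by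
  intro w0 hw0
  obtain ⟨r, hr, bd, hbd, hle⟩ := hb w0 hw0
  have hmem : w0 ∈ Metric.ball w0 r := Metric.mem_ball_self hr
  have key := hasDerivAt_integral_of_dominated_loc_of_deriv_le (𝕜 := ℂ) (μ := m) (F := F)
    (x₀ := w0) (s := Metric.ball w0 (r/4)) (bound := fun a => bd a / (r/4))
    (F' := fun w a => deriv (fun w => F w a) w)
    (Metric.ball_mem_nhds _ (by positivity)) (Filter.Eventually.of_forall hmeas)
    (hbd.mono' (hmeas w0) (hle.mono fun a ha => ha w0 hmem)) ?_ ?_ (hbd.div_const _) ?_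
  · exact key.2.differentiableAt
  · have hseq : Filter.Tendsto (fun n : ℕ => (1 / ((n:ℂ) + 1))) Filter.atTop (nhdsWithin 0 {0}ᶜ) := by
      rw [tendsto_nhdsWithin_iff]
      refine ⟨tendsto_one_div_add_atTop_nhds_zero_nat, Filter.Eventually.of_forall fun n => ?_⟩
      have : (n:ℂ) + 1 ≠ 0 := by exact_mod_cast Nat.succ_ne_zero n
      simp [this]
    refine aestronglyMeasurable_of_tendsto_ae Filter.atTop
      (f := fun (n : ℕ) a => (1 / ((n:ℂ) + 1))⁻¹ • (F (w0 + 1 / ((n:ℂ) + 1)) a - F w0 a)) ?_ ?_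
    · intro n
      exact ((hmeas _).sub (hmeas _)).const_smul ((1 / ((n:ℂ) + 1))⁻¹)
    · refine Filter.Eventually.of_forall fun a => ?_
      have := (hdiff a w0).hasDerivAt
      rw [hasDerivAt_iff_tendsto_slope_zero] at this
      exact this.comp hseq
  · filter_upwards [hle] with a ha w hw
    refine Complex.norm_deriv_le_of_forall_mem_sphere_norm_le (by positivity)
      (hdiff a).diffContOnCl ?_
    intro y hy
    apply ha
    rw [Metric.mem_ball] at hw ⊢
    rw [Metric.mem_sphere] at hy
    linarith [dist_triangle y w w0]
  · exact Filter.Eventually.of_forall fun a w _ => (hdiff a w).hasDerivAt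

/-- half-line Gaussian transform -/
noncomputable def pcE (c : ℂ) : ℂ := ∫ x in Ioi (0:ℝ), Complex.exp (-(x:ℂ)^2/2 + c * x)

theorem pc_gint (c : ℂ) : Integrable (fun x : ℝ => Complex.exp (-(x:ℂ)^2/2 + c * x)) := by
  have := integrable_cexp_quadratic (b := 1/2) (by norm_num) c 0
  refine this.congr (Filter.Eventually.of_forall fun x => ?_)
  simp only
  congr 1; ring

theorem pc_gnorm (c : ℂ) (x : ℝ) :
    ‖Complex.exp (-(x:ℂ)^2/2 + c * x)‖ = Real.exp (-x^2/2 + c.re * x) := by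
  rw [Complex.norm_exp]
  congr 1
  have : (-(x:ℂ)^2/2 + c * x) = ((-x^2/2 : ℝ):ℂ) + c * x := by push_cast; ring
  rw [this, Complex.add_re, Complex.ofReal_re]
  simp

theorem pc_rint (r : ℝ) : Integrable (fun x : ℝ => Real.exp (-x^2/2 + r * x)) := by
  have := (pc_gint r).norm
  simp only [pc_gnorm, ofReal_re] at this
  exact this

theorem pc_norm_int (c : ℂ) :
    ∫ x in Ioi (0:ℝ), ‖Complex.exp (-(x:ℂ)^2/2 + c * x)‖ = ‖pcE c.re‖ := by
  have h : pcE c.re = ((∫ x in Ioi (0:ℝ), Real.exp (-x^2/2 + c.re * x) : ℝ) : ℂ) := by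
    rw [pcE, ← integral_complex_ofReal]
    congr 1
    ext x
    push_cast
    rfl
  rw [h, Complex.norm_real, Real.norm_of_nonneg (integral_nonneg fun x => (Real.exp_pos _).le)]
  simp only [pc_gnorm]

theorem pcE_diff : Differentiable ℂ pcE := by
  intro w0
  refine pc_holo (m := volume.restrict (Ioi (0:ℝ))) (U := univ)
    (F := fun c x => Complex.exp (-(x:ℂ)^2/2 + c * x)) (fun c => (pc_gint c).1.restrict)
    (fun a => by fun_prop) ?_ w0 (mem_univ _)
  intro w0 _
  refine ⟨1, one_pos, fun x => Real.exp (-x^2/2 + (w0.re + 1) * x), (pc_rint _).restrict, ?_⟩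
  filter_upwards [ae_restrict_mem measurableSet_Ioi] with x hx w hw
  rw [pc_gnorm]
  have h1 : w.re ≤ w0.re + 1 := by
    have := (Complex.re_le_norm (w - w0)).trans (mem_ball_iff_norm.1 hw).le
    simp at this; linarith
  have : (0:ℝ) < x := hx
  gcongr

theorem pcE_bound (R : ℝ) : ∃ C > 0, ∀ c : ℂ, c.re ≤ R → ‖pcE c‖ * (1 + ‖c‖) ≤ C := by
  set A := ∫ x in Ioi (0:ℝ), Real.exp (-x^2/2 + R * x) with hA
  set B := ∫ x in Ioi (0:ℝ), Real.exp (-x^2/2 + (R+1) * x) with hB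
  have hA0 : 0 ≤ A := integral_nonneg fun x => (Real.exp_pos _).le
  have hB0 : 0 ≤ B := integral_nonneg fun x => (Real.exp_pos _).le
  refine ⟨A + (1 + B), by positivity, fun c hc => ?_⟩
  have h1 : ‖pcE c‖ ≤ A := by
    refine norm_integral_le_of_norm_le (pc_rint R).restrict ?_
    filter_upwards [ae_restrict_mem measurableSet_Ioi] with x hx
    have : (0:ℝ) < x := hx
    rw [pc_gnorm]; gcongr
  have hbd : ∀ᵐ x : ℝ ∂(volume.restrict (Ioi (0:ℝ))),
      ‖(x:ℂ) * Complex.exp (-(x:ℂ)^2/2 + c * x)‖ ≤ Real.exp (-x^2/2 + (R+1) * x) := by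
    filter_upwards [ae_restrict_mem measurableSet_Ioi] with x hx
    have hx : (0:ℝ) < x := hx
    rw [norm_mul, pc_gnorm, Complex.norm_real, Real.norm_of_nonneg hx.le]
    have : -x^2/2 + (R+1) * x = x + (-x^2/2 + R * x) := by ring
    rw [this, Real.exp_add x]
    have e1 : x ≤ Real.exp x := by linarith [Real.add_one_le_exp x]
    have e2 : Real.exp (-x^2/2 + c.re * x) ≤ Real.exp (-x^2/2 + R * x) := by gcongr
    exact mul_le_mul e1 e2 (Real.exp_pos _).le (Real.exp_pos _).le
  have hxint : IntegrableOn (fun x : ℝ => (x:ℂ) * Complex.exp (-(x:ℂ)^2/2 + c * x)) (Ioi 0) :=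
    (pc_rint (R+1)).restrict.mono' (by fun_prop) hbd
  have h2 : ‖∫ x in Ioi (0:ℝ), (x:ℂ) * Complex.exp (-(x:ℂ)^2/2 + c * x)‖ ≤ B :=
    norm_integral_le_of_norm_le (pc_rint _).restrict hbd
  have h3 : ∫ x in Ioi (0:ℝ), (c * Complex.exp (-(x:ℂ)^2/2 + c * x)
      - (x:ℂ) * Complex.exp (-(x:ℂ)^2/2 + c * x)) = 0 - Complex.exp (-((0:ℝ):ℂ)^2/2 + c * (0:ℝ)) := by
    have hI : IntegrableOn (fun x : ℝ => (c * Complex.exp (-(x:ℂ)^2/2 + c * x)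
      - (x:ℂ) * Complex.exp (-(x:ℂ)^2/2 + c * x))) (Ioi 0) :=
      ((pc_gint c).restrict.const_mul c).sub hxint
    have hd : ∀ x ∈ Ioi (0:ℝ), HasDerivAt (fun x : ℝ => Complex.exp (-(x:ℂ)^2/2 + c * x))
      ((c * Complex.exp (-(x:ℂ)^2/2 + c * x)
      - (x:ℂ) * Complex.exp (-(x:ℂ)^2/2 + c * x))) x := by
      intro x _
      have h0 : HasDerivAt (fun x : ℝ => (x:ℂ)) 1 x := Complex.ofRealCLM.hasDerivAt
      have := ((((h0.pow 2).neg.div_const 2).add (h0.const_mul c))).cexp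
      refine this.congr_deriv ?_
      simp
      ring
    refine integral_Ioi_of_hasDerivAt_of_tendsto (by fun_prop) hd hI ?_
    exact tendsto_zero_of_hasDerivAt_of_integrableOn_Ioi hd hI (pc_gint c).restrict
  rw [integral_sub ((pc_gint c).restrict.const_mul c) hxint, integral_const_mul] at h3
  change c * pcE c - _ = _ at h3
  have h4 : c * pcE c = (∫ x in Ioi (0:ℝ), (x:ℂ) * Complex.exp (-(x:ℂ)^2/2 + c * x)) - 1 := by
    simp at h3
    linear_combination h3
  have h5 : ‖c‖ * ‖pcE c‖ ≤ B + 1 := by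
    rw [← norm_mul, h4]
    refine (norm_sub_le _ _).trans ?_
    simpa using h2
  rw [mul_add, mul_one, mul_comm ‖pcE c‖ ‖c‖]
  linarith

theorem pcE_add (c : ℂ) : pcE c + pcE (-c) = (Real.sqrt (2 * Real.pi) : ℂ) * Complex.exp (c^2/2) := by
  have h1 : pcE (-c) = ∫ x in Iic (0:ℝ), Complex.exp (-(x:ℂ)^2/2 + c * x) := by
    have := integral_comp_neg_Ioi (0:ℝ) (fun x : ℝ => Complex.exp (-(x:ℂ)^2/2 + c * x))
    rw [neg_zero] at this
    rw [← this, pcE]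
    congr 1; ext x; push_cast; congr 1; ring
  rw [h1, pcE, add_comm, ← setIntegral_union (by simp) measurableSet_Ioi
    (pc_gint c).integrableOn (pc_gint c).integrableOn, Iic_union_Ioi, setIntegral_univ]
  have := integral_cexp_quadratic (b := -1/2) (by norm_num) c 0
  have h2 : ∀ x : ℝ, Complex.exp (-(x:ℂ)^2/2 + c * x) = Complex.exp ((-1/2) * (x:ℂ)^2 + c * x + 0) := by
    intro x; congr 1; ring
  simp only [h2]
  rw [this]
  congr 1
  · have : (Real.pi : ℂ) / -(-1/2) = ((2 * Real.pi : ℝ) : ℂ) := by push_cast; ring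
    rw [this, Real.sqrt_eq_rpow, Complex.ofReal_cpow (by positivity)]
    norm_num
  · congr 1; ring

noncomputable abbrev pcQ : Measure (ℝ × ℝ) :=
  (volume.restrict (Ioi (0:ℝ))).prod (volume.restrict (Ioi (0:ℝ)))

theorem pcQ_pos : ∀ᵐ p ∂pcQ, 0 < p.1 ∧ 0 < p.2 := by
  rw [pcQ, Measure.prod_restrict]
  filter_upwards [ae_restrict_mem (measurableSet_Ioi.prod measurableSet_Ioi)] with p hp
  exact hp

theorem pc_gam_int {β r : ℝ} (hβ : 0 < β) (hr : 0 < r) :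
    IntegrableOn (fun s : ℝ => s^(β-1) * Real.exp (-(r * s))) (Ioi 0) := by
  have := integrableOn_rpow_mul_exp_neg_mul_rpow (p := 1) (s := β - 1) (b := r) (by linarith)
    one_pos hr
  simpa using this

theorem pc_dom1 {a β : ℝ} (hβ : 0 < β) (h : a - β < 1) :
    Integrable (fun p : ℝ × ℝ => (Ioi (1:ℝ)).indicator (fun t => t^(a-2)) p.1 *
      (p.2^(β-1) * Real.exp (-(p.1/2 * p.2)))) pcQ := by
  have hm : Measurable (fun p : ℝ × ℝ => (Ioi (1:ℝ)).indicator (fun t => t^(a-2)) p.1 *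
      (p.2^(β-1) * Real.exp (-(p.1/2 * p.2)))) := by
    have : Measurable ((Ioi (1:ℝ)).indicator (fun t : ℝ => t^(a-2))) :=
      (by fun_prop : Measurable fun t : ℝ => t^(a-2)).indicator measurableSet_Ioi
    fun_prop
  rw [pcQ, integrable_prod_iff hm.aestronglyMeasurable]
  constructor
  · filter_upwards [ae_restrict_mem measurableSet_Ioi] with t ht
    have ht : 0 < t := ht
    exact (pc_gam_int hβ (by positivity : 0 < t/2)).const_mul _
  · have h1 : IntegrableOn (fun t : ℝ => (Ioi (1:ℝ)).indicator
        (fun t => t^(a-2-β) * (2^β * Real.Gamma β)) t) (Ioi 0) := by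
      have : IntegrableOn (fun t : ℝ => t^(a-2-β) * (2^β * Real.Gamma β)) (Ioi 1) :=
        (integrableOn_Ioi_rpow_of_lt (a := a-2-β) (by linarith) one_pos).mul_const _
      exact (this.integrable_indicator measurableSet_Ioi).restrict
    refine h1.congr_fun (fun t ht => ?_) measurableSet_Ioi
    have ht : 0 < t := ht
    have h2 : ∀ s ∈ Ioi (0:ℝ), ‖(Ioi (1:ℝ)).indicator (fun t => t^(a-2)) t *
      (s^(β-1) * Real.exp (-(t/2 * s)))‖ = (Ioi (1:ℝ)).indicator (fun t => t^(a-2)) t *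
      (s^(β-1) * Real.exp (-(t/2 * s))) := by
      intro s hs
      have hs : 0 < s := hs
      refine Real.norm_of_nonneg (mul_nonneg (indicator_nonneg (fun x hx => ?_) _) (by positivity))
      have : (1:ℝ) < x := hx
      positivity
    simp only
    rw [setIntegral_congr_fun measurableSet_Ioi h2, integral_const_mul,
      Real.integral_rpow_mul_exp_neg_mul_Ioi hβ (by positivity)]
    by_cases h1t : t ∈ Ioi (1:ℝ)
    · rw [indicator_of_mem h1t, indicator_of_mem h1t, one_div_div,
        Real.div_rpow (by norm_num) ht.le, Real.rpow_sub ht (a-2) β]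
      ring
    · rw [indicator_of_notMem h1t, indicator_of_notMem h1t, zero_mul]

noncomputable def pcD (a β : ℝ) (p : ℝ × ℝ) : ℝ :=
  p.1^(a-1) * p.2^(β-1) * Real.exp (-(p.1 * p.2 / 2)) / (1 + p.1 + p.2)

theorem pcD_int {a β : ℝ} (ha : 0 < a) (hβ : 0 < β) (h1 : a - β < 1) (h2 : β - a < 1) :
    Integrable (pcD a β) pcQ := by
  have i1 := pc_dom1 hβ h1
  have i2 := (pc_dom1 ha h2).swap
  have i0 : ∀ a : ℝ, 0 < a → Integrable ((Ioc (0:ℝ) 1).indicator fun t => t^(a-1))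
      (volume.restrict (Ioi (0:ℝ))) := by
    intro a ha
    have := (intervalIntegral.intervalIntegrable_rpow' (a := 0) (b := 1)
      (by linarith : -1 < a - 1)).1
    exact (this.integrable_indicator measurableSet_Ioc).restrict
  have i3 := (i0 a ha).mul_prod (i0 β hβ)
  refine ((i3.add i1).add i2).mono' (by unfold pcD; exact (by fun_prop : Measurable _).aestronglyMeasurable) ?_
  filter_upwards [pcQ_pos] with p hp
  obtain ⟨t, s⟩ := p
  obtain ⟨ht, hs⟩ := hp
  simp only at ht hs
  simp only [pcD, Pi.add_apply, Function.comp_apply, Prod.swap_prod_mk]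
  rw [Real.norm_of_nonneg (by positivity)]
  have n0 : ∀ a t : ℝ, 0 ≤ (Ioc (0:ℝ) 1).indicator (fun t => t^(a-1)) t := fun a t =>
    indicator_nonneg (fun x hx => by have := hx.1; positivity) _
  have n1 : ∀ a t : ℝ, 0 ≤ (Ioi (1:ℝ)).indicator (fun t => t^(a-2)) t := fun a t =>
    indicator_nonneg (fun x hx => by have : (1:ℝ) < x := hx; positivity) _
  have p0 := mul_nonneg (n0 a t) (n0 β s)
  have p1 : 0 ≤ (Ioi (1:ℝ)).indicator (fun t => t^(a-2)) t * (s^(β-1) * Real.exp (-(t/2 * s))) :=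
    mul_nonneg (n1 a t) (by positivity)
  have p2 : 0 ≤ (Ioi (1:ℝ)).indicator (fun t => t^(β-2)) s * (t^(a-1) * Real.exp (-(s/2 * t))) :=
    mul_nonneg (n1 β s) (by positivity)
  have key : ∀ a t : ℝ, 0 < t → t^(a-2) = t^(a-1) / t := by
    intro a t ht
    rw [← Real.rpow_sub_one ht.ne']; congr 1; ring
  by_cases c1 : 1 < t
  · have : t^(a-1) * s^(β-1) * Real.exp (-(t * s / 2)) / (1 + t + s) ≤
      (Ioi (1:ℝ)).indicator (fun t => t^(a-2)) t * (s^(β-1) * Real.exp (-(t/2 * s))) := by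
      rw [indicator_of_mem (show t ∈ Ioi (1:ℝ) from c1), key a t ht,
        show t / 2 * s = t * s / 2 by ring,
        show t^(a-1) / t * (s^(β-1) * Real.exp (-(t * s / 2))) =
          t^(a-1) * s^(β-1) * Real.exp (-(t * s / 2)) / t by ring]
      gcongr
      linarith
    linarith
  by_cases c2 : 1 < s
  · have : t^(a-1) * s^(β-1) * Real.exp (-(t * s / 2)) / (1 + t + s) ≤
      (Ioi (1:ℝ)).indicator (fun t => t^(β-2)) s * (t^(a-1) * Real.exp (-(s/2 * t))) := by
      rw [indicator_of_mem (show s ∈ Ioi (1:ℝ) from c2), key β s hs,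
        show s / 2 * t = t * s / 2 by ring,
        show s^(β-1) / s * (t^(a-1) * Real.exp (-(t * s / 2))) =
          t^(a-1) * s^(β-1) * Real.exp (-(t * s / 2)) / s by ring]
      gcongr
      linarith
    linarith
  have : t^(a-1) * s^(β-1) * Real.exp (-(t * s / 2)) / (1 + t + s) ≤
      (Ioc (0:ℝ) 1).indicator (fun t => t^(a-1)) t * (Ioc (0:ℝ) 1).indicator (fun t => t^(β-1)) s := by
    rw [indicator_of_mem (show t ∈ Ioc (0:ℝ) 1 from ⟨ht, not_lt.1 c1⟩),
      indicator_of_mem (show s ∈ Ioc (0:ℝ) 1 from ⟨hs, not_lt.1 c2⟩), mul_div_assoc]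
    refine mul_le_of_le_one_right (by positivity) ?_
    rw [div_le_one (by positivity)]
    have : Real.exp (-(t * s / 2)) ≤ 1 := by
      rw [Real.exp_le_one_iff]; have := mul_pos ht hs; linarith
    linarith
  linarith

/-- elementary inequality used for the uniform domination -/
theorem pc_elem {t s : ℝ} (ht : 0 < t) (hs : 0 < s) :
    1 + t + s ≤ 4 * Real.exp (t * s / 2) * (1 + |t - s|) := by
  have key : ∀ t s : ℝ, 0 < t → 0 < s → s ≤ t → 1 + t + s ≤ 4 * Real.exp (t * s / 2) * (1 + |t - s|) := by
    intro t s ht hs hst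
    rw [abs_of_nonneg (by linarith)]
    have h1 : 1 + s^2/2 ≤ Real.exp (t * s / 2) := by
      have := Real.add_one_le_exp (t * s / 2)
      nlinarith
    have h2 : 4 * (1 + s^2/2) * (1 + (t - s)) ≤ 4 * Real.exp (t * s / 2) * (1 + (t - s)) := by
      have : 0 ≤ 1 + (t - s) := by linarith
      gcongr
    have h3 : (1 + 2 * s) * (1 + (t - s)) ≤ 4 * (1 + s^2/2) * (1 + (t - s)) := by
      have : 0 ≤ 1 + (t - s) := by linarith
      gcongr
      nlinarith [sq_nonneg (s - 1)]
    nlinarith [mul_nonneg hs.le (sub_nonneg.2 hst)]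
  rcases le_total s t with h | h
  · exact key t s ht hs h
  · have := key s t hs ht h
    rw [abs_sub_comm, mul_comm t s]
    linarith

theorem pcE_bound2 (ζ : ℂ) : ∃ C > 0, ∀ v : ℂ, 0 ≤ v.re → ‖pcE (ζ - v)‖ * (1 + ‖v‖) ≤ C := by
  obtain ⟨C, hC, h⟩ := pcE_bound ζ.re
  refine ⟨C * (1 + ‖ζ‖), by positivity, fun v hv => ?_⟩
  have h1 := h (ζ - v) (by simp [hv])
  have h2 : 1 + ‖v‖ ≤ (1 + ‖ζ - v‖) * (1 + ‖ζ‖) := by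
    have : ‖v‖ ≤ ‖ζ‖ + ‖ζ - v‖ := by
      have := norm_sub_le ζ (ζ - v)
      simpa using this
    nlinarith [norm_nonneg ζ, norm_nonneg (ζ - v), mul_nonneg (norm_nonneg ζ) (norm_nonneg (ζ - v))]
  calc ‖pcE (ζ - v)‖ * (1 + ‖v‖) ≤ ‖pcE (ζ - v)‖ * ((1 + ‖ζ - v‖) * (1 + ‖ζ‖)) := by gcongr
    _ = (‖pcE (ζ - v)‖ * (1 + ‖ζ - v‖)) * (1 + ‖ζ‖) := by ring
    _ ≤ _ := by gcongr

noncomputable def pcf (ν b ζ w : ℂ) (p : ℝ × ℝ) : ℂ :=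
  (p.1:ℂ)^(ν-1) * (p.2:ℂ)^(b-1) * Complex.exp (-((p.1:ℂ) * p.2)) *
    pcE (ζ - ((p.1:ℂ) * Complex.exp w + (p.2:ℂ) * Complex.exp (-w)))

theorem pcf_meas (ν b ζ w : ℂ) : Measurable (pcf ν b ζ w) := by
  have := pcE_diff.continuous.measurable
  unfold pcf
  fun_prop

theorem pcf_diff (ν b ζ : ℂ) (p : ℝ × ℝ) : Differentiable ℂ (fun w => pcf ν b ζ w p) := by
  have := pcE_diff
  unfold pcf
  fun_prop

theorem pcf_bd (ν b ζ : ℂ) : ∃ C > 0, ∀ (w : ℂ) (t s K : ℝ), 0 < t → 0 < s →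
    0 ≤ ((t:ℂ) * Complex.exp w + (s:ℂ) * Complex.exp (-w)).re →
    1 + t + s ≤ K * Real.exp (t * s / 2) *
      (1 + ‖(t:ℂ) * Complex.exp w + (s:ℂ) * Complex.exp (-w)‖) →
    ‖pcf ν b ζ w (t, s)‖ ≤ (C * K) * pcD ν.re b.re (t, s) := by
  obtain ⟨C, hC, h⟩ := pcE_bound2 ζ
  refine ⟨C, hC, fun w t s K ht hs hv hK => ?_⟩
  have h1 := h _ hv
  set v := (t:ℂ) * Complex.exp w + (s:ℂ) * Complex.exp (-w) with hvdef
  have hn : ‖pcf ν b ζ w (t, s)‖ = t^(ν.re-1) * s^(b.re-1) * Real.exp (-(t*s)) * ‖pcE (ζ - v)‖ := by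
    simp only [pcf, norm_mul, Complex.norm_cpow_eq_rpow_re_of_pos ht,
      Complex.norm_cpow_eq_rpow_re_of_pos hs, Complex.norm_exp]
    simp [hvdef]
  have hK0 : 0 ≤ K := by
    by_contra hcon
    have : K * Real.exp (t * s / 2) * (1 + ‖v‖) ≤ 0 :=
      mul_nonpos_of_nonpos_of_nonneg (mul_nonpos_of_nonpos_of_nonneg (by linarith)
        (Real.exp_pos _).le) (by positivity)
    linarith
  have hE : Real.exp (-(t*s)) * Real.exp (t*s/2) = Real.exp (-(t*s/2)) := by
    rw [← Real.exp_add]; congr 1; ring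
  have h2 : Real.exp (-(t*s)) * ‖pcE (ζ - v)‖ * (1 + t + s) ≤ C * K * Real.exp (-(t*s/2)) := by
    calc Real.exp (-(t*s)) * ‖pcE (ζ - v)‖ * (1 + t + s)
        ≤ Real.exp (-(t*s)) * ‖pcE (ζ - v)‖ * (K * Real.exp (t * s / 2) * (1 + ‖v‖)) := by gcongr
      _ = (Real.exp (-(t*s)) * Real.exp (t*s/2)) * K * (‖pcE (ζ - v)‖ * (1 + ‖v‖)) := by ring
      _ ≤ (Real.exp (-(t*s)) * Real.exp (t*s/2)) * K * C := by gcongr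
      _ = _ := by rw [hE]; ring
  rw [hn, pcD, mul_assoc (t^(ν.re-1) * s^(b.re-1))]
  simp only
  rw [← mul_div_assoc, le_div_iff₀ (by positivity)]
  calc t^(ν.re-1) * s^(b.re-1) * (Real.exp (-(t*s)) * ‖pcE (ζ - v)‖) * (1 + t + s)
      = t^(ν.re-1) * s^(b.re-1) * (Real.exp (-(t*s)) * ‖pcE (ζ - v)‖ * (1 + t + s)) := by ring
    _ ≤ t^(ν.re-1) * s^(b.re-1) * (C * K * Real.exp (-(t*s/2))) := by gcongr
    _ = _ := by ring

noncomputable def pcN (ν b ζ w : ℂ) : ℂ := ∫ p, pcf ν b ζ w p ∂pcQ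

def pcS : Set ℂ := {w | |w.im| < Real.pi / 2}

theorem pcS_eq : pcS = Complex.im ⁻¹' (Ioo (-(Real.pi/2)) (Real.pi/2)) := by
  ext w; simp [pcS, abs_lt]

theorem pcS_open : IsOpen pcS := by
  rw [pcS_eq]; exact isOpen_Ioo.preimage Complex.continuous_im

theorem pcS_conn : IsPreconnected pcS := by
  rw [pcS_eq]
  exact ((convex_Ioo _ _).is_linear_preimage (f := Complex.im)
    ⟨Complex.add_im, by simp⟩).isPreconnected

theorem pcf_local (ν b ζ : ℂ) (hν : 0 < ν.re) (hb : 0 < b.re) (h1 : ν.re - b.re < 1)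
    (h2 : b.re - ν.re < 1) (w0 : ℂ) (hw0 : w0 ∈ pcS) :
    ∃ r > 0, ∃ bd : ℝ × ℝ → ℝ, Integrable bd pcQ ∧
      ∀ᵐ p ∂pcQ, ∀ w ∈ Metric.ball w0 r, ‖pcf ν b ζ w p‖ ≤ bd p := by
  obtain ⟨C, hC, h⟩ := pcf_bd ν b ζ
  have hc : 0 < Real.cos w0.im := by
    rw [pcS_eq] at hw0
    exact Real.cos_pos_of_mem_Ioo hw0
  have e1 : 0 < (Complex.exp w0).re := by
    rw [Complex.exp_re]; positivity
  have e2 : 0 < (Complex.exp (-w0)).re := by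
    rw [Complex.exp_re, Complex.neg_im, Real.cos_neg]; positivity
  obtain ⟨δ, hδ, hδ1, hδ2⟩ : ∃ δ > 0, δ < (Complex.exp w0).re ∧ δ < (Complex.exp (-w0)).re := by
    obtain ⟨δ, h0, h1⟩ := exists_between (lt_min e1 e2)
    exact ⟨δ, h0, lt_min_iff.1 h1⟩
  have c1 : Continuous fun w : ℂ => (Complex.exp w).re := by fun_prop
  have c2 : Continuous fun w : ℂ => (Complex.exp (-w)).re := by fun_prop
  have ev := (c1.continuousAt.eventually (lt_mem_nhds hδ1)).and
    (c2.continuousAt.eventually (lt_mem_nhds hδ2))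
  obtain ⟨r, hr, hball⟩ := Metric.eventually_nhds_iff_ball.1 ev
  refine ⟨r, hr, fun p => (C * (1 + 1/δ)) * pcD ν.re b.re p, (pcD_int hν hb h1 h2).const_mul _, ?_⟩
  filter_upwards [pcQ_pos] with p hp w hw
  obtain ⟨t, s⟩ := p
  obtain ⟨ht, hs⟩ := hp
  simp only at ht hs
  obtain ⟨g1, g2⟩ := hball w hw
  have hre : δ * (t + s) ≤ ((t:ℂ) * Complex.exp w + (s:ℂ) * Complex.exp (-w)).re := by
    rw [Complex.add_re, Complex.re_ofReal_mul, Complex.re_ofReal_mul]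
    nlinarith
  have hn := hre.trans (Complex.re_le_norm _)
  refine h w t s _ ht hs (le_trans (by positivity) hre) ?_
  set V := ‖(t:ℂ) * Complex.exp w + (s:ℂ) * Complex.exp (-w)‖ with hV
  have hV0 : 0 ≤ V := norm_nonneg _
  have q1 : t + s ≤ 1/δ * V := by
    rw [one_div, ← div_eq_inv_mul, le_div_iff₀ hδ]; linarith
  have q2 : 1 ≤ Real.exp (t * s / 2) := Real.one_le_exp (by positivity)
  have q3 : 0 < 1/δ := by positivity
  calc 1 + t + s ≤ (1 + 1/δ) * 1 * (1 + V) := by nlinarith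
    _ ≤ _ := by gcongr

theorem pcN_real (ν b ζ : ℂ) (hν : 0 < ν.re) (hb : 0 < b.re) (h1 : ν.re - b.re < 1)
    (h2 : b.re - ν.re < 1) (r : ℝ) :
    Complex.exp ((r:ℂ) * (ν - b)) * pcN ν b ζ r = pcN ν b ζ 0 := by
  have hint : ∀ r : ℝ, Integrable (pcf ν b ζ r) pcQ := by
    intro r
    obtain ⟨ρ, hρ, bd, hbd, hle⟩ := pcf_local ν b ζ hν hb h1 h2 r
      (by simp [pcS, Real.pi_pos])
    exact hbd.mono' (pcf_meas ν b ζ r).aestronglyMeasurable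
      (hle.mono fun p hp => hp _ (Metric.mem_ball_self hρ))
  have key : ∀ t ∈ Ioi (0:ℝ), ∀ s ∈ Ioi (0:ℝ), Complex.exp ((r:ℂ) * (ν - b)) * pcf ν b ζ r (t, s)
      = pcf ν b ζ 0 (Real.exp r * t, Real.exp (-r) * s) := by
    intro t ht s hs
    have ht : 0 < t := ht
    have hs : 0 < s := hs
    simp only [pcf]
    have e1 : ((Real.exp r * t : ℝ) : ℂ)^(ν-1) = Complex.exp (r * (ν - 1)) * (t:ℂ)^(ν-1) := by
      rw [Complex.ofReal_mul, Complex.mul_cpow_ofReal_nonneg (Real.exp_pos _).le ht.le,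
        Complex.cpow_def_of_ne_zero (by exact_mod_cast (Real.exp_pos r).ne'),
        ← Complex.ofReal_log (Real.exp_pos _).le, Real.log_exp]
    have e2 : ((Real.exp (-r) * s : ℝ) : ℂ)^(b-1) = Complex.exp (-r * (b - 1)) * (s:ℂ)^(b-1) := by
      rw [Complex.ofReal_mul, Complex.mul_cpow_ofReal_nonneg (Real.exp_pos _).le hs.le,
        Complex.cpow_def_of_ne_zero (by exact_mod_cast (Real.exp_pos (-r)).ne'),
        ← Complex.ofReal_log (Real.exp_pos _).le, Real.log_exp]
      push_cast; rfl
    have e3 : (Complex.exp r) * Complex.exp (-r) = 1 := by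
      rw [← Complex.exp_add]; simp
    have e4 : ((Real.exp r * t : ℝ) : ℂ) * ((Real.exp (-r) * s : ℝ) : ℂ) = t * s := by
      push_cast
      linear_combination (t:ℂ) * s * e3
    have e5 : Complex.exp ((r:ℂ) * (ν - b)) =
        Complex.exp (r * (ν - 1)) * Complex.exp (-r * (b - 1)) := by
      rw [← Complex.exp_add]; congr 1; ring
    rw [e4, e1, e2, e5]
    have e6 : ((Real.exp r * t : ℝ) : ℂ) * Complex.exp 0 + ((Real.exp (-r) * s : ℝ) : ℂ) *
        Complex.exp (-0) = t * Complex.exp r + s * Complex.exp (-r) := by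
      push_cast; simp; ring
    rw [e6]
    ring
  have hint0 := hint 0
  rw [Complex.ofReal_zero] at hint0
  rw [pcN, pcN, ← integral_const_mul, integral_prod _ ((hint r).const_mul _), integral_prod _ hint0]
  have s1 : ∀ t ∈ Ioi (0:ℝ), (∫ s in Ioi (0:ℝ), Complex.exp ((r:ℂ) * (ν - b)) * pcf ν b ζ r (t, s))
      = (fun y => Real.exp r • ∫ s in Ioi (0:ℝ), pcf ν b ζ 0 (y, s)) (Real.exp r * t) := by
    intro t ht
    rw [setIntegral_congr_fun measurableSet_Ioi (key t ht)]
    have := integral_comp_mul_left_Ioi (fun s => pcf ν b ζ 0 (Real.exp r * t, s)) 0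
      (Real.exp_pos (-r))
    rw [this, mul_zero, Real.exp_neg, inv_inv]
  rw [setIntegral_congr_fun measurableSet_Ioi s1, integral_comp_mul_left_Ioi
      (fun y => Real.exp r • ∫ s in Ioi (0:ℝ), pcf ν b ζ 0 (y, s)) 0 (Real.exp_pos r),
    integral_smul, smul_smul, inv_mul_cancel₀ (Real.exp_pos r).ne', one_smul, mul_zero]

theorem pcN_strip (ν b ζ : ℂ) (hν : 0 < ν.re) (hb : 0 < b.re) (h1 : ν.re - b.re < 1)
    (h2 : b.re - ν.re < 1) (w : ℂ) (hw : w ∈ pcS) :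
    Complex.exp (w * (ν - b)) * pcN ν b ζ w = pcN ν b ζ 0 := by
  have hd : DifferentiableOn ℂ (fun w => Complex.exp (w * (ν - b)) * pcN ν b ζ w) pcS := by
    intro w hw
    have : DifferentiableAt ℂ (fun w => pcN ν b ζ w) w := pc_holo (U := pcS)
      (fun w => (pcf_meas ν b ζ w).aestronglyMeasurable) (pcf_diff ν b ζ)
      (pcf_local ν b ζ hν hb h1 h2) w hw
    refine DifferentiableAt.differentiableWithinAt ?_
    fun_prop
  have h0 : (0:ℂ) ∈ pcS := by simp [pcS, Real.pi_pos]
  have := (hd.analyticOnNhd pcS_open).eqOn_of_preconnected_of_frequently_eq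
    (g := fun _ => pcN ν b ζ 0) analyticOnNhd_const pcS_conn h0 ?_
  · exact this hw
  · have hseq : Filter.Tendsto (fun n : ℕ => (1 / ((n:ℂ) + 1))) Filter.atTop (nhdsWithin 0 {0}ᶜ) := by
      rw [tendsto_nhdsWithin_iff]
      refine ⟨tendsto_one_div_add_atTop_nhds_zero_nat, Filter.Eventually.of_forall fun n => ?_⟩
      have : (n:ℂ) + 1 ≠ 0 := by exact_mod_cast Nat.succ_ne_zero n
      simp [this]
    refine hseq.frequently (Filter.Frequently.of_forall fun n => ?_)
    have := pcN_real ν b ζ hν hb h1 h2 (1 / ((n:ℝ) + 1))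
    push_cast at this
    exact this

theorem pcf_bdry (ν b ζ : ℂ) : ∃ C > 0, ∀ θ ∈ Icc (-(Real.pi/2)) (Real.pi/2), ∀ t s : ℝ,
    0 < t → 0 < s → ‖pcf ν b ζ (θ * I) (t, s)‖ ≤ C * pcD ν.re b.re (t, s) := by
  obtain ⟨C, hC, h⟩ := pcf_bd ν b ζ
  refine ⟨C * 4, by positivity, fun θ hθ t s ht hs => h _ t s 4 ht hs ?_ ?_⟩
  · have hc : 0 ≤ Real.cos θ := Real.cos_nonneg_of_mem_Icc hθ
    rw [Complex.add_re, Complex.re_ofReal_mul, Complex.re_ofReal_mul, Complex.exp_re,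
      Complex.exp_re]
    simp
    positivity
  · refine (pc_elem ht hs).trans ?_
    gcongr
    have := abs_norm_sub_norm_le ((t:ℂ) * Complex.exp (θ * I)) (-((s:ℂ) * Complex.exp (-(θ * I))))
    rw [sub_neg_eq_add, norm_neg, norm_mul, norm_mul, Complex.norm_exp, Complex.norm_exp] at this
    simpa [abs_of_pos ht, abs_of_pos hs] using this

theorem pcf_bdry_int (ν b ζ : ℂ) (hν : 0 < ν.re) (hb : 0 < b.re) (h1 : ν.re - b.re < 1)
    (h2 : b.re - ν.re < 1) (θ : ℝ) (hθ : θ ∈ Icc (-(Real.pi/2)) (Real.pi/2)) :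
    Integrable (pcf ν b ζ (θ * I)) pcQ := by
  obtain ⟨C, hC, h⟩ := pcf_bdry ν b ζ
  refine ((pcD_int hν hb h1 h2).const_mul C).mono' (pcf_meas _ _ _ _).aestronglyMeasurable ?_
  filter_upwards [pcQ_pos] with p hp
  exact h θ hθ p.1 p.2 hp.1 hp.2

theorem pcN_bdry (ν b ζ : ℂ) (hν : 0 < ν.re) (hb : 0 < b.re) (h1 : ν.re - b.re < 1)
    (h2 : b.re - ν.re < 1) (θ : ℝ) (hθ : θ ∈ Icc (-(Real.pi/2)) (Real.pi/2)) :
    Complex.exp (θ * I * (ν - b)) * pcN ν b ζ (θ * I) = pcN ν b ζ 0 := by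
  obtain ⟨C, hC, h⟩ := pcf_bdry ν b ζ
  have hc : ContinuousOn (fun θ : ℝ => pcN ν b ζ (θ * I)) (Icc (-(Real.pi/2)) (Real.pi/2)) := by
    refine continuousOn_of_dominated (bound := fun p => C * pcD ν.re b.re p)
      (fun θ _ => (pcf_meas _ _ _ _).aestronglyMeasurable) ?_
      ((pcD_int hν hb h1 h2).const_mul C) ?_
    · intro θ hθ
      filter_upwards [pcQ_pos] with p hp
      exact h θ hθ p.1 p.2 hp.1 hp.2
    · refine Filter.Eventually.of_forall fun p => ?_
      have := (pcf_diff ν b ζ p).continuous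
      exact (this.comp (by fun_prop : Continuous fun θ : ℝ => (θ:ℂ) * I)).continuousOn
  have hpi := Real.pi_pos
  have : EqOn (fun θ : ℝ => Complex.exp (θ * I * (ν - b)) * pcN ν b ζ (θ * I))
      (fun _ => pcN ν b ζ 0) (Icc (-(Real.pi/2)) (Real.pi/2)) := by
    refine EqOn.of_subset_closure (s := Ioo (-(Real.pi/2)) (Real.pi/2)) ?_ ?_
      continuousOn_const Ioo_subset_Icc_self ?_
    · intro θ hθ
      refine pcN_strip ν b ζ hν hb h1 h2 _ ?_
      rw [pcS_eq]
      simpa using hθ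
    · exact ContinuousOn.mul (by fun_prop) hc
    · rw [closure_Ioo (by linarith)]
  exact this hθ

noncomputable def pcW (ν b : ℂ) (x : ℝ) : ℂ :=
  ∫ u in Ioi (0:ℝ), Complex.exp (-(x:ℂ)^2 * u) * (u:ℂ) ^ (ν - 1) * ((1:ℂ) + (u:ℂ)) ^ (-b)

theorem pc_inner (ν b : ℂ) (hb : 0 < b.re) (x : ℝ) (hx : 0 < x) :
    (∫ t in Ioi (0:ℝ), ∫ s in Ioi (0:ℝ), (t:ℂ)^(ν-1) * (s:ℂ)^(b-1) *
      Complex.exp (-((t:ℂ) * s)) * Complex.exp (-((t:ℂ) + s) * x)) =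
    Complex.Gamma b * ((x:ℂ)^(ν-b) * pcW ν b x) := by
  have s1 : ∀ t ∈ Ioi (0:ℝ), (∫ s in Ioi (0:ℝ), (t:ℂ)^(ν-1) * (s:ℂ)^(b-1) *
      Complex.exp (-((t:ℂ) * s)) * Complex.exp (-((t:ℂ) + s) * x)) =
      (t:ℂ)^(ν-1) * Complex.exp (-((t:ℂ) * x)) * ((1 / ((t + x : ℝ):ℂ))^b * Complex.Gamma b) := by
    intro t ht
    have ht : 0 < t := ht
    rw [← Complex.integral_cpow_mul_exp_neg_mul_Ioi hb (by positivity : 0 < t + x),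
      ← integral_const_mul]
    congr 1; ext s
    have : Complex.exp (-((t:ℂ) * s)) * Complex.exp (-((t:ℂ) + s) * x) =
        Complex.exp (-((t:ℂ) * x)) * Complex.exp (-(((t + x : ℝ):ℂ) * s)) := by
      rw [← Complex.exp_add, ← Complex.exp_add]; congr 1; push_cast; ring
    linear_combination (t:ℂ)^(ν-1) * (s:ℂ)^(b-1) * this
  rw [setIntegral_congr_fun measurableSet_Ioi s1]
  have s2 := integral_comp_mul_left_Ioi' (fun t : ℝ => (t:ℂ)^(ν-1) * Complex.exp (-((t:ℂ) * x)) *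
    ((1 / ((t + x : ℝ):ℂ))^b * Complex.Gamma b)) 0 hx
  rw [mul_zero] at s2
  rw [← s2, pcW, ← integral_const_mul, ← integral_const_mul, ← integral_smul]
  refine setIntegral_congr_fun measurableSet_Ioi fun u hu => ?_
  have hu : 0 < u := hu
  have hxc : (x:ℂ) ≠ 0 := by exact_mod_cast hx.ne'
  have e1 : ((x * u : ℝ):ℂ)^(ν-1) = (x:ℂ)^(ν-1) * (u:ℂ)^(ν-1) := by
    rw [Complex.ofReal_mul, Complex.mul_cpow_ofReal_nonneg hx.le hu.le]
  have e2 : (1 / ((x * u + x : ℝ):ℂ))^b = (x:ℂ)^(-b) * ((1:ℂ) + u)^(-b) := by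
    have : x * u + x = x * (1 + u) := by ring
    rw [this, one_div, Complex.inv_cpow, ← Complex.cpow_neg, Complex.ofReal_mul,
      Complex.mul_cpow_ofReal_nonneg hx.le (by positivity)]
    · push_cast; rfl
    · rw [Complex.arg_ofReal_of_nonneg (by positivity)]
      exact Real.pi_pos.ne
  have e3 : (x:ℂ)^(ν-b) = x * ((x:ℂ)^(ν-1) * (x:ℂ)^(-b)) := by
    rw [← Complex.cpow_add _ _ hxc]
    nth_rewrite 2 [← Complex.cpow_one (x:ℂ)]
    rw [← Complex.cpow_add _ _ hxc]
    congr 1; ring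
  simp only [Complex.real_smul]
  rw [e1, e2, e3]
  have e4 : -(((x * u : ℝ):ℂ) * x) = -(x:ℂ)^2 * u := by push_cast; ring
  rw [e4]
  ring

theorem pcN_zero (ν b ζ : ℂ) (hν : 0 < ν.re) (hb : 0 < b.re) (h1 : ν.re - b.re < 1)
    (h2 : b.re - ν.re < 1) :
    IntegrableOn (fun x : ℝ => Complex.exp (-(x:ℂ)^2/2 + ζ * x) * (Complex.Gamma b *
      ((x:ℂ)^(ν-b) * pcW ν b x))) (Ioi 0) ∧
    pcN ν b ζ 0 = ∫ x in Ioi (0:ℝ), Complex.exp (-(x:ℂ)^2/2 + ζ * x) * (Complex.Gamma b *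
      ((x:ℂ)^(ν-b) * pcW ν b x)) := by
  set H : (ℝ × ℝ) → ℝ → ℂ := fun p x => ((p.1:ℂ)^(ν-1) * (p.2:ℂ)^(b-1) *
    Complex.exp (-((p.1:ℂ) * p.2))) * Complex.exp (-(x:ℂ)^2/2 + (ζ - (p.1 + p.2)) * x) with hH
  have hpi := Real.pi_pos
  have hm : Measurable (Function.uncurry H) := by
    simp only [hH, Function.uncurry_def]
    fun_prop
  have hR : Integrable (pcf ν.re b.re ζ.re 0) pcQ := by
    have := pcf_bdry_int ν.re b.re ζ.re (by simpa) (by simpa) (by simpa) (by simpa) 0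
      ⟨by linarith, by linarith⟩
    simpa using this
  have hHint : Integrable (Function.uncurry H) (pcQ.prod (volume.restrict (Ioi (0:ℝ)))) := by
    rw [integrable_prod_iff hm.aestronglyMeasurable]
    constructor
    · refine Filter.Eventually.of_forall fun p => ?_
      simp only [hH, Function.uncurry_apply_pair]
      exact ((pc_gint _).restrict).const_mul _
    · refine hR.norm.congr ?_
      filter_upwards [pcQ_pos] with p hp
      obtain ⟨t, s⟩ := p
      obtain ⟨ht, hs⟩ := hp
      simp only at ht hs
      simp only [hH, Function.uncurry_apply_pair, norm_mul _ (Complex.exp (_ + _))]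
      rw [integral_const_mul, pc_norm_int, pcf]
      simp only [norm_mul, Complex.norm_cpow_eq_rpow_re_of_pos ht,
        Complex.norm_cpow_eq_rpow_re_of_pos hs]
      simp
  have hin : ∀ᵐ x ∂(volume.restrict (Ioi (0:ℝ))), ∫ p, H p x ∂pcQ =
      Complex.exp (-(x:ℂ)^2/2 + ζ * x) * (Complex.Gamma b * ((x:ℂ)^(ν-b) * pcW ν b x)) := by
    filter_upwards [hHint.prod_left_ae, ae_restrict_mem measurableSet_Ioi] with x hxi hx
    have hx : 0 < x := hx
    rw [← pc_inner ν b hb x hx]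
    have hxi' : Integrable (fun p => H p x) pcQ := hxi
    rw [pcQ, integral_prod _ hxi', ← integral_const_mul]
    congr 1; ext t
    rw [← integral_const_mul]
    congr 1; ext s
    simp only [hH]
    have : Complex.exp (-(x:ℂ)^2/2 + (ζ - (t + s)) * x) =
        Complex.exp (-(x:ℂ)^2/2 + ζ * x) * Complex.exp (-((t:ℂ) + s) * x) := by
      rw [← Complex.exp_add]; congr 1; ring
    rw [this]; ring
  refine ⟨hHint.integral_prod_right.congr hin, ?_⟩
  rw [← integral_congr_ae hin, ← integral_integral_swap hHint, pcN]
  congr 1; ext p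
  simp only [hH]
  rw [integral_const_mul, pcf, pcE]
  simp

theorem pc_pair (ν b z : ℂ) (hν : 0 < ν.re) (hb : 0 < b.re) (h1 : ν.re - b.re < 1)
    (h2 : b.re - ν.re < 1) :
    pcN ν b (I * z) ((Real.pi/2 : ℝ) * I) + pcN ν b (-(I * z)) ((-(Real.pi/2) : ℝ) * I) =
    (Real.sqrt (2 * Real.pi) : ℂ) * (Complex.exp (-z^2/2) *
      ((∫ t in Ioi (0:ℝ), Complex.exp (z * t - (t:ℂ)^2 / 2) * (t:ℂ) ^ (ν - 1)) *
        (∫ s in Ioi (0:ℝ), Complex.exp (-z * s - (s:ℂ)^2 / 2) * (s:ℂ) ^ (b - 1)))) := by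
  have hpi := Real.pi_pos
  rw [pcN, pcN, ← integral_add (pcf_bdry_int ν b _ hν hb h1 h2 _ ⟨by linarith, le_rfl⟩)
    (pcf_bdry_int ν b _ hν hb h1 h2 _ ⟨le_rfl, by linarith⟩), ← integral_prod_mul,
    ← integral_const_mul, ← integral_const_mul]
  congr 1; ext ⟨t, s⟩
  have x1 : Complex.exp ((Real.pi/2 : ℝ) * I) = I := by
    push_cast; exact Complex.exp_pi_div_two_mul_I
  have x2 : Complex.exp ((-(Real.pi/2) : ℝ) * I) = -I := by
    push_cast; rw [← neg_div]; exact Complex.exp_neg_pi_div_two_mul_I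
  have x3 : -(((-(Real.pi/2) : ℝ):ℂ) * I) = (Real.pi/2 : ℝ) * I := by push_cast; ring
  have x4 : -(((Real.pi/2 : ℝ):ℂ) * I) = (-(Real.pi/2) : ℝ) * I := by push_cast; ring
  simp only [pcf]
  rw [x3, x4, x1, x2]
  have y1 : I * z - ((t:ℂ) * I + s * -I) = I * (z - t + s) := by ring
  have y2 : -(I * z) - ((t:ℂ) * -I + s * I) = -(I * (z - t + s)) := by ring
  rw [y1, y2, ← mul_add, pcE_add]
  have key : Complex.exp (-((t:ℂ) * s)) * Complex.exp ((I * (z - t + s))^2/2) =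
      Complex.exp (-z^2/2) * (Complex.exp (z * t - (t:ℂ)^2 / 2) *
        Complex.exp (-z * s - (s:ℂ)^2 / 2)) := by
    rw [← Complex.exp_add, ← Complex.exp_add, ← Complex.exp_add]
    congr 1
    rw [mul_pow, Complex.I_sq]
    ring
  linear_combination (t:ℂ)^(ν-1) * (s:ℂ)^(b-1) * (Real.sqrt (2 * Real.pi) : ℂ) * key

/-- The Fourier-cosine identity (26) with `a = 1`:
`D₋ν(z) D_(μ-1-ν)(-z) + D₋ν(-z) D_(μ-1-ν)(z)
  = (4/√(2π)) sin(πμ/2) ∫₀^∞ cos(zx) x^(μ-1) e^(-x²/2) Ψ(ν,μ;x²) dx`,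
with Ψ and each D written via their integral representations. -/
theorem product_parabolic_cylinder_fourier_cosine
    (ν μ z : ℂ) (hν : 0 < ν.re) (hμ0 : 0 < μ.re) (hμ2 : μ.re < 2)
    (hμν : μ.re < ν.re + 1) :
    (Complex.exp (-z^2 / 2) / (Complex.Gamma ν * Complex.Gamma (ν + 1 - μ))) *
      ((∫ t in Ioi (0:ℝ), Complex.exp (-z * t - (t:ℂ)^2 / 2) * (t:ℂ) ^ (ν - 1)) *
        (∫ s in Ioi (0:ℝ), Complex.exp (z * s - (s:ℂ)^2 / 2) * (s:ℂ) ^ (ν - μ)) +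
       (∫ t in Ioi (0:ℝ), Complex.exp (z * t - (t:ℂ)^2 / 2) * (t:ℂ) ^ (ν - 1)) *
        (∫ s in Ioi (0:ℝ), Complex.exp (-z * s - (s:ℂ)^2 / 2) * (s:ℂ) ^ (ν - μ))) =
    ((4 / Real.sqrt (2 * Real.pi) : ℝ) : ℂ) * Complex.sin ((Real.pi : ℂ) * μ / 2) *
      ∫ x in Ioi (0:ℝ), Complex.cos (z * x) *
        (x:ℂ) ^ (μ - 1) * Complex.exp (-(x:ℂ)^2 / 2) *
        ((1 / Complex.Gamma ν) *
          ∫ u in Ioi (0:ℝ), Complex.exp (-(x:ℂ)^2 * u) * (u:ℂ) ^ (ν - 1) *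
            ((1:ℂ) + (u:ℂ)) ^ (μ - ν - 1)) := by
  have hb : 0 < (ν + 1 - μ).re := by simp; linarith
  have h1 : ν.re - (ν + 1 - μ).re < 1 := by simp; linarith
  have h2 : (ν + 1 - μ).re - ν.re < 1 := by simp; linarith
  have hpi := Real.pi_pos
  have P1 := pc_pair ν (ν + 1 - μ) z hν hb h1 h2
  have P2 := pc_pair ν (ν + 1 - μ) (-z) hν hb h1 h2
  have B1 := pcN_bdry ν (ν + 1 - μ) (I * z) hν hb h1 h2 (Real.pi/2) ⟨by linarith, le_rfl⟩
  have B2 := pcN_bdry ν (ν + 1 - μ) (-(I * z)) hν hb h1 h2 (Real.pi/2) ⟨by linarith, le_rfl⟩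
  have B3 := pcN_bdry ν (ν + 1 - μ) (I * z) hν hb h1 h2 (-(Real.pi/2)) ⟨le_rfl, by linarith⟩
  have B4 := pcN_bdry ν (ν + 1 - μ) (-(I * z)) hν hb h1 h2 (-(Real.pi/2)) ⟨le_rfl, by linarith⟩
  obtain ⟨i1, Z1⟩ := pcN_zero ν (ν + 1 - μ) (I * z) hν hb h1 h2
  obtain ⟨i2, Z2⟩ := pcN_zero ν (ν + 1 - μ) (-(I * z)) hν hb h1 h2
  have hG1 : Complex.Gamma ν ≠ 0 := Complex.Gamma_ne_zero_of_re_pos hν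
  have hG2 : Complex.Gamma (ν + 1 - μ) ≠ 0 := Complex.Gamma_ne_zero_of_re_pos hb
  have hZ : pcN ν (ν + 1 - μ) (I * z) 0 + pcN ν (ν + 1 - μ) (-(I * z)) 0 =
      (2 * Complex.Gamma (ν + 1 - μ) * Complex.Gamma ν) *
      ∫ x in Ioi (0:ℝ), Complex.cos (z * x) *
        (x:ℂ) ^ (μ - 1) * Complex.exp (-(x:ℂ)^2 / 2) *
        ((1 / Complex.Gamma ν) *
          ∫ u in Ioi (0:ℝ), Complex.exp (-(x:ℂ)^2 * u) * (u:ℂ) ^ (ν - 1) *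
            ((1:ℂ) + (u:ℂ)) ^ (μ - ν - 1)) := by
    rw [Z1, Z2, ← integral_add i1 i2, ← integral_const_mul]
    congr 1; ext x
    have w1 : pcW ν (ν + 1 - μ) x = ∫ u in Ioi (0:ℝ), Complex.exp (-(x:ℂ)^2 * u) *
        (u:ℂ) ^ (ν - 1) * ((1:ℂ) + (u:ℂ)) ^ (μ - ν - 1) := by
      rw [pcW, show -(ν + 1 - μ) = μ - ν - 1 by ring]
    rw [← w1, show ν - (ν + 1 - μ) = μ - 1 by ring, Complex.cos, Complex.exp_add, Complex.exp_add,
      show z * x * I = I * z * x by ring, show -(z * x) * I = -(I * z) * x by ring]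
    field_simp
  set X := ∫ x in Ioi (0:ℝ), Complex.cos (z * x) *
        (x:ℂ) ^ (μ - 1) * Complex.exp (-(x:ℂ)^2 / 2) *
        ((1 / Complex.Gamma ν) *
          ∫ u in Ioi (0:ℝ), Complex.exp (-(x:ℂ)^2 * u) * (u:ℂ) ^ (ν - 1) *
            ((1:ℂ) + (u:ℂ)) ^ (μ - ν - 1)) with hX
  rw [show ν + 1 - μ - 1 = ν - μ by ring] at P1 P2
  rw [show I * -z = -(I * z) by ring, neg_neg, neg_neg, neg_sq] at P2
  rw [show ν - (ν + 1 - μ) = μ - 1 by ring] at B1 B2 B3 B4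
  set A1 := ∫ t in Ioi (0:ℝ), Complex.exp (-z * t - (t:ℂ)^2 / 2) * (t:ℂ) ^ (ν - 1)
  set A2 := ∫ t in Ioi (0:ℝ), Complex.exp (z * t - (t:ℂ)^2 / 2) * (t:ℂ) ^ (ν - 1)
  set C1 := ∫ s in Ioi (0:ℝ), Complex.exp (-z * s - (s:ℂ)^2 / 2) * (s:ℂ) ^ (ν - μ)
  set C2 := ∫ s in Ioi (0:ℝ), Complex.exp (z * s - (s:ℂ)^2 / 2) * (s:ℂ) ^ (ν - μ)
  set e1 := Complex.exp (((Real.pi/2 : ℝ):ℂ) * I * (μ - 1)) with he1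
  set e2 := Complex.exp (((-(Real.pi/2) : ℝ):ℂ) * I * (μ - 1)) with he2
  have he : e1 * e2 = 1 := by
    rw [he1, he2, ← Complex.exp_add]; push_cast; ring_nf; simp
  have hsin : e1 + e2 = 2 * Complex.sin ((Real.pi : ℂ) * μ / 2) := by
    have : (Real.pi : ℂ) * μ / 2 = Real.pi / 2 * (μ - 1) + Real.pi / 2 := by ring
    rw [this, Complex.sin_add_pi_div_two, Complex.two_cos, he1, he2]
    congr 2 <;> (push_cast; ring)
  have hmain : (Real.sqrt (2 * Real.pi) : ℂ) * (Complex.exp (-z^2/2) * (A1 * C2 + A2 * C1)) =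
      2 * Complex.sin ((Real.pi : ℂ) * μ / 2) *
        (2 * Complex.Gamma (ν + 1 - μ) * Complex.Gamma ν * X) := by
    rw [← hsin, ← hZ]
    have b1 : pcN ν (ν + 1 - μ) (I * z) ((Real.pi/2 : ℝ) * I) =
      e2 * pcN ν (ν + 1 - μ) (I * z) 0 := by rw [← B1]; linear_combination (-pcN ν (ν + 1 - μ) (I * z) ((Real.pi/2 : ℝ) * I)) * he
    have b2 : pcN ν (ν + 1 - μ) (-(I * z)) ((Real.pi/2 : ℝ) * I) =
      e2 * pcN ν (ν + 1 - μ) (-(I * z)) 0 := by rw [← B2]; linear_combination (-pcN ν (ν + 1 - μ) (-(I * z)) ((Real.pi/2 : ℝ) * I)) * he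
    have b3 : pcN ν (ν + 1 - μ) (I * z) ((-(Real.pi/2) : ℝ) * I) =
      e1 * pcN ν (ν + 1 - μ) (I * z) 0 := by rw [← B3]; linear_combination (-pcN ν (ν + 1 - μ) (I * z) ((-(Real.pi/2) : ℝ) * I)) * he
    have b4 : pcN ν (ν + 1 - μ) (-(I * z)) ((-(Real.pi/2) : ℝ) * I) =
      e1 * pcN ν (ν + 1 - μ) (-(I * z)) 0 := by rw [← B4]; linear_combination (-pcN ν (ν + 1 - μ) (-(I * z)) ((-(Real.pi/2) : ℝ) * I)) * he
    rw [b1, b4] at P1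
    rw [b2, b3] at P2
    linear_combination -P1 - P2
  have hsq : (Real.sqrt (2 * Real.pi) : ℂ) ≠ 0 := by
    exact_mod_cast (Real.sqrt_pos.2 (by positivity)).ne'
  rw [Complex.ofReal_div, div_mul_eq_mul_div, div_mul_eq_mul_div, div_mul_eq_mul_div,
    div_eq_div_iff (mul_ne_zero hG1 hG2) hsq]
  push_cast
  linear_combination hmain
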